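/- Let q = p^k be a prime power with q ≡ 1 (mod 4), and let f : F_q → F_q preserve positivity on M_2(F_q) with f(1) = 1. Assume additionally that f is injective on F_q^+. Then there exists an integer j with 0 ≤ j ≤ k−1 such that f(x) = x^{p^j} for all x ∈ F_q. -/

import Mathlib

/-- An element of a field is *positive* if it is a nonzero square. -/
def IsPos {F : Type*} [Field F] (x : F) : Prop := ∃ y : F, y ≠ 0 ∧ y ^ 2 = x

/-- The `r`-th leading principal minor of a square matrix (the determinant of the
top-left `(r+1) × (r+1)` submatrix). -/
def leadingMinor {F : Type*} [CommRing F] {n : ℕ} (A : Matrix (Fin n) (Fin n) F)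
    (r : Fin n) : F :=
  (A.submatrix (Fin.castLE r.isLt) (Fin.castLE r.isLt)).det

/-- A matrix over a finite field is positive definite if it is symmetric and all its
leading principal minors are positive (nonzero squares). -/
def IsPosDef {F : Type*} [Field F] {n : ℕ} (A : Matrix (Fin n) (Fin n) F) : Prop :=
  A.IsSymm ∧ ∀ r : Fin n, IsPos (leadingMinor A r)

/-- The entrywise application `f[A]` of `f` to the matrix `A`. -/
def entrywiseMap {F : Type*} {n : ℕ} (f : F → F) (A : Matrix (Fin n) (Fin n) F) :
    Matrix (Fin n) (Fin n) F := Matrix.of fun i j => f (A i j)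

/-- `f` preserves positivity on `n × n` matrices. -/
def PreservesPos {F : Type*} [Field F] (n : ℕ) (f : F → F) : Prop :=
  ∀ A : Matrix (Fin n) (Fin n) F, IsPosDef A → IsPosDef (entrywiseMap f A)


section PowerMaps

variable {F : Type*} [Field F] [Fintype F]

theorem sum_units_pow_mul_inv_hom [DecidableEq F] (ψ : Fˣ →* Fˣ) (l : ℕ) :
    ∑ u : Fˣ, (((u ^ l * (ψ u)⁻¹ : Fˣ)) : F) = if ∀ u, ψ u = u ^ l then -1 else 0 := by
  let χ : Fˣ →* F := (Units.coeHom F).comp (powMonoidHom l * ψ⁻¹)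
  have key : χ = 1 ↔ ∀ u, ψ u = u ^ l := by
    rw [DFunLike.ext_iff]
    refine forall_congr' fun u => ?_
    change ((u ^ l * (ψ u)⁻¹ : Fˣ) : F) = 1 ↔ _
    rw [Units.val_eq_one, mul_inv_eq_one, eq_comm]
  have h := sum_hom_units χ
  change ∑ u : Fˣ, (((u ^ l * (ψ u)⁻¹ : Fˣ)) : F) = _ at h
  rw [h]
  simp only [key]
  split_ifs
  · rw [Fintype.card_units, Nat.cast_sub Fintype.card_pos]
    simp
  · simp

theorem sum_units_inv_hom_mul_sub_one_pow [DecidableEq F] (ψ : Fˣ →* Fˣ) (m : ℕ) :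
    ∑ u : Fˣ, (((ψ u)⁻¹ : Fˣ) : F) * ((u : F) - 1) ^ m =
      ∑ l ∈ Finset.range (m + 1), (-1) ^ (l + m) * (m.choose l : F) *
        if ∀ u, ψ u = u ^ l then -1 else 0 := by
  simp_rw [← sum_units_pow_mul_inv_hom, Finset.mul_sum]
  rw [Finset.sum_comm]
  refine Finset.sum_congr rfl fun u _ => ?_
  rw [sub_pow, Finset.mul_sum]
  refine Finset.sum_congr rfl fun l _ => ?_
  push_cast
  ring

theorem units_pow_injOn {m : ℕ} (hm : Fintype.card F = 2 * m + 1) (hm0 : 0 < m) {i l : ℕ}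
    (hi : i ≤ m) (hl : l ≤ m) (h : ∀ u : Fˣ, u ^ i = u ^ l) : i = l := by
  wlog hil : i ≤ l generalizing i l
  · exact (this hl hi (fun u => (h u).symm) (by omega)).symm
  have : Fintype.card F - 1 ∣ l - i := by
    rw [← FiniteField.forall_pow_eq_one_iff]
    intro u
    have := h u
    rw [← Nat.add_sub_cancel' hil, pow_add] at this
    simpa using this.symm
  rcases Nat.eq_zero_or_pos (l - i) with h0 | h0
  · omega
  · have := Nat.le_of_dvd h0 this
    omega

/-- A multiplicative automorphism compatible with the quadratic character acts on the exponents
occurring in `(X - 1) ^ m`. -/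
theorem exists_pow_eq_of_sub_one_pow_eq {m : ℕ} (hm : Fintype.card F = 2 * m + 1) (hm0 : 0 < m)
    (φ : Fˣ ≃* Fˣ) (h : ∀ u, ((φ u : F) - 1) ^ m = ((u : F) - 1) ^ m) {i : ℕ}
    (hi : (m.choose i : F) ≠ 0) :
    ∃ l, (m.choose l : F) ≠ 0 ∧ ∀ u, φ u ^ i = u ^ l := by
  classical
  by_contra! hne
  have him : i ≤ m := by
    by_contra hlt
    exact hi (by rw [Nat.choose_eq_zero_of_lt (by omega), Nat.cast_zero])
  have h1 := sum_units_inv_hom_mul_sub_one_pow (F := F) (powMonoidHom i) m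
  have h2 := sum_units_inv_hom_mul_sub_one_pow (F := F) ((powMonoidHom i).comp φ.toMonoidHom) m
  have h12 : ∑ u : Fˣ, ((((powMonoidHom i) u)⁻¹ : Fˣ) : F) * ((u : F) - 1) ^ m =
      ∑ u : Fˣ, (((((powMonoidHom i).comp φ.toMonoidHom) u)⁻¹ : Fˣ) : F) * ((u : F) - 1) ^ m := by
    rw [← Equiv.sum_comp φ.toEquiv]
    refine Finset.sum_congr rfl fun u _ => ?_
    rw [← h u]
    rfl
  rw [h1, h2, Finset.sum_eq_single i] at h12
  · rw [Finset.sum_eq_zero] at h12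
    · simp [hi] at h12
    · intro l _
      by_cases hl : (m.choose l : F) = 0
      · simp [hl]
      · obtain ⟨u, hu⟩ := hne l hl
        rw [if_neg, mul_zero]
        exact fun hall => hu (hall u)
  · intro l hl hli
    rw [if_neg, mul_zero]
    intro hall
    exact hli (units_pow_injOn hm hm0 him (by simpa [Nat.lt_succ_iff] using hl) hall).symm
  · intro hmem
    exact absurd (Finset.mem_range.2 (by omega)) hmem

end PowerMaps

theorem exists_eq_prime_pow_of_dvd_choose {p : ℕ} (hp : p.Prime) (e : ℕ) (he : 0 < e)
    (h : ∀ v, 0 < v → v < e → p ∣ e.choose v) : ∃ j, e = p ^ j := by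
  induction e using Nat.strong_induction_on with
  | _ e ih =>
    have := Fact.mk hp
    rcases Nat.lt_or_ge 1 e with he1 | he1
    · obtain ⟨n, rfl⟩ : p ∣ e := by simpa using h 1 one_pos he1
      have hn : 0 < n := Nat.pos_of_mul_pos_left he
      obtain ⟨j, rfl⟩ := ih n (by nlinarith [hp.two_le]) hn fun v hv hvn => by
        have hd := h (p * v) (Nat.mul_pos hp.pos hv) (Nat.mul_lt_mul_of_pos_left hvn hp.pos)
        have hl := Choose.choose_modEq_choose_mod_mul_choose_div_nat (n := p * n) (k := p * v)
          (p := p)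
        rw [Nat.mul_mod_right, Nat.mul_mod_right, Nat.mul_div_cancel_left _ hp.pos,
          Nat.mul_div_cancel_left _ hp.pos, Nat.choose_self, one_mul] at hl
        exact (hl.dvd_iff dvd_rfl).1 hd
      exact ⟨j + 1, by rw [pow_succ']⟩
    · exact ⟨0, by rw [pow_zero]; omega⟩

theorem mulEquiv_units_eq_prime_pow {F : Type*} [Field F] [Fintype F] {p m : ℕ} (hp : p.Prime)
    [CharP F p] (hm : Fintype.card F = 2 * m + 1) (hm0 : 0 < m) (φ : Fˣ ≃* Fˣ)
    (h : ∀ u, ((φ u : F) - 1) ^ m = ((u : F) - 1) ^ m) :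
    ∃ j, p ^ j ≤ m ∧ ∀ u, φ u = u ^ p ^ j := by
  have hle : ∀ {i : ℕ}, (m.choose i : F) ≠ 0 → i ≤ m := fun {i} hi => by
    by_contra hlt
    exact hi (by rw [Nat.choose_eq_zero_of_lt (by omega), Nat.cast_zero])
  have hmF : (m : F) ≠ 0 := by
    intro h0
    have := FiniteField.cast_card_eq_zero F
    rw [hm] at this
    push_cast at this
    simp [h0] at this
  obtain ⟨e, he, hφ⟩ := exists_pow_eq_of_sub_one_pow_eq hm hm0 φ h (i := 1) (by simpa using hmF)
  simp only [pow_one] at hφ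
  have hsymm : ∀ u, ((φ.symm u : F) - 1) ^ m = ((u : F) - 1) ^ m := fun u => by
    rw [← h (φ.symm u), MulEquiv.apply_symm_apply]
  have hchoose : ∀ v, 0 < v → v < e → p ∣ e.choose v := by
    intro v hv hve
    rw [← CharP.cast_eq_zero_iff F p]
    by_contra hev
    have key : ∀ w, w ≤ e → (e.choose w : F) ≠ 0 → (m.choose w : F) ≠ 0 := by
      intro w hw hew hmw
      have := congrArg (Nat.cast (R := F)) (Nat.choose_mul (n := m) hw)
      push_cast at this
      rw [hmw, zero_mul] at this
      exact (mul_ne_zero he hew) this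
    obtain ⟨s, hs, hs'⟩ := exists_pow_eq_of_sub_one_pow_eq hm hm0 φ.symm hsymm
      (key v hve.le hev)
    obtain ⟨t, ht, ht'⟩ := exists_pow_eq_of_sub_one_pow_eq hm hm0 φ.symm hsymm
      (key (e - v) (by omega) (by rwa [Nat.choose_symm hve.le]))
    have hst : ∀ u : Fˣ, u ^ (s + t) = u := fun u => by
      rw [pow_add, ← hs', ← ht', ← pow_add, Nat.add_sub_cancel' hve.le, ← hφ,
        MulEquiv.apply_symm_apply]
    have hvw : ∀ w, w ≤ m → (∀ u : Fˣ, φ.symm u ^ w = u ^ 0) → w = 0 := fun w hw hw' =>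
      units_pow_injOn hm hm0 hw (Nat.zero_le m) fun u => by
        simpa using hw' (φ u)
    have hs0 : s ≠ 0 := by
      rintro rfl
      have := hvw v (hve.le.trans (hle he)) hs'
      omega
    have ht0 : t ≠ 0 := by
      rintro rfl
      have := hvw (e - v) ((Nat.sub_le _ _).trans (hle he)) ht'
      omega
    have hdvd : Fintype.card F - 1 ∣ s + t - 1 := by
      rw [← FiniteField.forall_pow_eq_one_iff]
      intro u
      have := hst u
      rw [show s + t = s + t - 1 + 1 by omega, pow_succ] at this
      simpa using this
    have := Nat.le_of_dvd (by omega) hdvd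
    have := hle hs
    have := hle ht
    omega
  have he0 : 0 < e := by
    rcases Nat.eq_zero_or_pos e with rfl | h0
    · have := units_pow_injOn (F := F) hm hm0 (i := 1) (l := 0) hm0 (Nat.zero_le m) fun u => by
        simpa using hφ (φ.symm u)
      omega
    · exact h0
  obtain ⟨j, rfl⟩ := exists_eq_prime_pow_of_dvd_choose hp e he0 hchoose
  exact ⟨j, hle he, hφ⟩

section Positive

variable {F : Type*} [Field F]

theorem IsPos.ne_zero {x : F} (hx : IsPos x) : x ≠ 0 := by
  obtain ⟨y, hy, rfl⟩ := hx
  exact pow_ne_zero 2 hy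

theorem isPos_iff_isSquare {x : F} (hx : x ≠ 0) : IsPos x ↔ IsSquare x := by
  constructor
  · rintro ⟨y, -, rfl⟩
    exact IsSquare.sq y
  · rintro ⟨y, rfl⟩
    exact ⟨y, left_ne_zero_of_mul hx, sq y⟩

theorem isPos_sq {x : F} (hx : x ≠ 0) : IsPos (x ^ 2) := ⟨x, hx, rfl⟩

theorem isPos_one : IsPos (1 : F) := ⟨1, one_ne_zero, one_pow 2⟩

theorem IsPos.mul {x y : F} (hx : IsPos x) (hy : IsPos y) : IsPos (x * y) := by
  obtain ⟨a, ha, rfl⟩ := hx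
  obtain ⟨b, hb, rfl⟩ := hy
  exact ⟨a * b, mul_ne_zero ha hb, mul_pow a b 2⟩

theorem IsPos.inv {x : F} (hx : IsPos x) : IsPos x⁻¹ := by
  obtain ⟨a, ha, rfl⟩ := hx
  exact ⟨a⁻¹, inv_ne_zero ha, inv_pow a 2⟩

theorem IsPos.div {x y : F} (hx : IsPos x) (hy : IsPos y) : IsPos (x / y) := by
  rw [div_eq_mul_inv]
  exact hx.mul hy.inv

theorem IsPos.mul_iff {x y : F} (hx : IsPos x) : IsPos (x * y) ↔ IsPos y := by
  refine ⟨fun h => ?_, hx.mul⟩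
  have := h.div hx
  rwa [mul_div_cancel_left₀ _ hx.ne_zero] at this

variable [Fintype F] {m : ℕ}

theorem isPos_neg_one (hq : Fintype.card F % 4 = 1) : IsPos (-1 : F) :=
  (isPos_iff_isSquare (neg_ne_zero.2 one_ne_zero)).2
    (FiniteField.isSquare_neg_one_iff.2 (by omega))

theorem isPos_sub_comm (hq : Fintype.card F % 4 = 1) {x y : F} : IsPos (x - y) ↔ IsPos (y - x) := by
  rw [← (isPos_neg_one hq).mul_iff, neg_one_mul, neg_sub]

theorem ringChar_ne_two_of_card (hm : Fintype.card F = 2 * m + 1) : ringChar F ≠ 2 := by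
  rw [Ne, FiniteField.even_card_iff_char_two]
  omega

theorem isPos_iff_pow (hm : Fintype.card F = 2 * m + 1) {x : F} (hx : x ≠ 0) :
    IsPos x ↔ x ^ m = 1 := by
  rw [isPos_iff_isSquare hx, FiniteField.isSquare_iff (ringChar_ne_two_of_card hm) hx,
    show Fintype.card F / 2 = m by omega]

theorem pow_eq_neg_one_of_not_isPos (hm : Fintype.card F = 2 * m + 1) {x : F} (hx : x ≠ 0)
    (h : ¬ IsPos x) : x ^ m = -1 := by
  have := FiniteField.pow_dichotomy (ringChar_ne_two_of_card hm) hx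
  rw [show Fintype.card F / 2 = m by omega] at this
  exact this.resolve_left fun h1 => h ((isPos_iff_pow hm hx).2 h1)

theorem isPos_div_of_not_isPos (hm : Fintype.card F = 2 * m + 1) {x y : F} (hx : x ≠ 0)
    (hx' : ¬ IsPos x) (hy : y ≠ 0) (hy' : ¬ IsPos y) : IsPos (x / y) := by
  rw [isPos_iff_pow hm (div_ne_zero hx hy), div_pow, pow_eq_neg_one_of_not_isPos hm hx hx',
    pow_eq_neg_one_of_not_isPos hm hy hy', div_self (neg_ne_zero.2 one_ne_zero)]

theorem two_mul_natCast_half_card (hm : Fintype.card F = 2 * m + 1) : 2 * (m : F) = -1 := by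
  have := FiniteField.cast_card_eq_zero F
  rw [hm] at this
  push_cast at this
  exact eq_neg_of_add_eq_zero_left this

theorem sum_pow_eq_ite (hm : Fintype.card F = 2 * m + 1) {t : ℕ} (ht : t < 4 * m) :
    ∑ c : F, c ^ t = if t = 2 * m then -1 else 0 := by
  classical
  rcases Nat.eq_zero_or_pos t with rfl | ht0
  · rw [if_neg (by omega)]
    simp
  · have hs : ∑ c : F, c ^ t = ∑ u : Fˣ, (u : F) ^ t := by
      rw [← Fintype.sum_subtype_add_sum_subtype (fun c : F => c ≠ 0)]
      rw [← Equiv.sum_comp unitsEquivNeZero]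
      have : ∑ x : {c : F // ¬ c ≠ 0}, (x : F) ^ t = 0 :=
        Finset.sum_eq_zero fun x _ => by
          rw [not_not.1 x.2, zero_pow ht0.ne']
      rw [this, add_zero]
      rfl
    rw [hs, FiniteField.sum_pow_units, hm, Nat.add_sub_cancel]
    refine if_congr ⟨?_, ?_⟩ rfl rfl
    · rintro ⟨a, rfl⟩
      have : a < 2 := by
        by_contra! h2
        nlinarith [Nat.mul_le_mul_left (2 * m) h2]
      have : a ≠ 0 := by
        rintro rfl
        simp at ht0
      obtain rfl : a = 1 := by omega
      rw [mul_one]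
    · rintro rfl
      exact dvd_rfl

theorem sum_pow_mul_sub_pow (a m : ℕ) (x : F) :
    ∑ c : F, c ^ a * (c - x) ^ m =
      ∑ l ∈ Finset.range (m + 1), (-x) ^ (m - l) * (m.choose l : F) * ∑ c : F, c ^ (a + l) := by
  simp_rw [Finset.mul_sum]
  rw [Finset.sum_comm]
  refine Finset.sum_congr rfl fun c _ => ?_
  rw [sub_eq_add_neg, add_pow, Finset.mul_sum]
  refine Finset.sum_congr rfl fun l _ => ?_
  ring

open scoped Classical in
/-- The positive elements `c` for which `c - x` is positive as well. -/
noncomputable def posNeighbors (x : F) : Finset F :=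
  Finset.univ.filter fun c => IsPos c ∧ IsPos (c - x)

theorem mem_posNeighbors {x c : F} : c ∈ posNeighbors x ↔ IsPos c ∧ IsPos (c - x) := by
  simp [posNeighbors]

theorem four_mul_sum_posNeighbors_pow (hm : Fintype.card F = 2 * m + 1) {j : ℕ} (hj : 0 < j)
    (hjm : j < m) (x : F) :
    4 * ∑ c ∈ posNeighbors x, c ^ j = -((-x) ^ j * (m.choose j : F)) - (x ^ j + x ^ (m + j)) := by
  classical
  have h1 : ∀ c : F, (4 * if IsPos c ∧ IsPos (c - x) then c ^ j else 0) =
      c ^ j + c ^ (m + j) + c ^ j * (c - x) ^ m + c ^ (m + j) * (c - x) ^ m -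
        if c = x then x ^ j + x ^ (m + j) else 0 := by
    intro c
    have hm0 : m ≠ 0 := by omega
    by_cases hc : c = 0
    · subst hc
      have h0 : ¬ IsPos (0 : F) := fun h => h.ne_zero rfl
      rcases eq_or_ne 0 x with rfl | hx
      · simp [h0, hj.ne']
      · simp [h0, hj.ne', hx]
    by_cases hcx : c = x
    · subst hcx
      have h0 : ¬ IsPos (0 : F) := fun h => h.ne_zero rfl
      simp [h0, hm0]
    have hcx' : c - x ≠ 0 := sub_ne_zero.2 hcx
    rw [if_neg hcx, pow_add]
    by_cases hp1 : IsPos c <;> by_cases hp2 : IsPos (c - x)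
    · rw [if_pos ⟨hp1, hp2⟩, (isPos_iff_pow hm hc).1 hp1, (isPos_iff_pow hm hcx').1 hp2]
      ring
    · rw [if_neg (by tauto), (isPos_iff_pow hm hc).1 hp1, pow_eq_neg_one_of_not_isPos hm hcx' hp2]
      ring
    · rw [if_neg (by tauto), (isPos_iff_pow hm hcx').1 hp2, pow_eq_neg_one_of_not_isPos hm hc hp1]
      ring
    · rw [if_neg (by tauto), pow_eq_neg_one_of_not_isPos hm hcx' hp2,
        pow_eq_neg_one_of_not_isPos hm hc hp1]
      ring
  have h2 : ∑ c : F, c ^ j * (c - x) ^ m = 0 := by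
    rw [sum_pow_mul_sub_pow]
    refine Finset.sum_eq_zero fun l hl => ?_
    have : l < m + 1 := Finset.mem_range.1 hl
    rw [sum_pow_eq_ite hm (by omega), if_neg (by omega), mul_zero]
  have h3 : ∑ c : F, c ^ (m + j) * (c - x) ^ m = -((-x) ^ j * (m.choose j : F)) := by
    rw [sum_pow_mul_sub_pow, Finset.sum_eq_single (m - j)]
    · rw [sum_pow_eq_ite hm (by omega), if_pos (by omega), Nat.choose_symm hjm.le,
        Nat.sub_sub_self hjm.le]
      ring
    · intro l hl hlj
      have : l < m + 1 := Finset.mem_range.1 hl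
      rw [sum_pow_eq_ite hm (by omega), if_neg (by omega), mul_zero]
    · intro h
      exact absurd (Finset.mem_range.2 (by omega)) h
  rw [posNeighbors, Finset.sum_filter, Finset.mul_sum, Finset.sum_congr rfl fun c _ => h1 c,
    Finset.sum_sub_distrib, Finset.sum_add_distrib, Finset.sum_add_distrib, Finset.sum_add_distrib,
    h2, h3, sum_pow_eq_ite hm (by omega), sum_pow_eq_ite hm (by omega), if_neg (by omega),
    if_neg (by omega), Finset.sum_ite_eq', if_pos (Finset.mem_univ x)]
  ring

theorem posNeighbors_injOn_isPos (hm : Fintype.card F = 2 * m + 1) (hm3 : 3 < m) {x y : F}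
    (hx : IsPos x) (hy : IsPos y) (h : posNeighbors x = posNeighbors y) : x = y := by
  have h2m := two_mul_natCast_half_card (F := F) hm
  have h2 : (2 : F) ≠ 0 := fun h0 => by simp [h0] at h2m
  have hxm := (isPos_iff_pow hm hx.ne_zero).1 hx
  have hym := (isPos_iff_pow hm hy.ne_zero).1 hy
  have moment : ∀ {j : ℕ}, 0 < j → j < m → ((-1) ^ j * (m.choose j : F) + 2) ≠ 0 →
      x ^ j = y ^ j := by
    intro j hj hjm hK
    have := four_mul_sum_posNeighbors_pow hm hj hjm x
    rw [h, four_mul_sum_posNeighbors_pow hm hj hjm y, pow_add, pow_add, hxm, hym, neg_pow x,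
      neg_pow y] at this
    exact mul_right_cancel₀ hK (by linear_combination this)
  by_cases h5 : (5 : F) = 0
  · have hm' : (m : F) = 2 := mul_left_cancel₀ h2 (by linear_combination h2m - h5)
    have h3 : (3 : F) ≠ 0 := fun h0 => h2 (by linear_combination h5 - h0)
    have c2 : (m.choose 2 : F) = 1 := by
      have := congrArg (Nat.cast (R := F)) (Nat.add_one_mul_choose_eq (m - 1) 1)
      rw [Nat.sub_add_cancel (by omega), Nat.choose_one_right] at this
      push_cast [show 1 ≤ m by omega] at this
      rw [hm'] at this
      exact mul_right_cancel₀ h2 (by linear_combination -this)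
    have c3 : (m.choose 3 : F) = 0 := by
      have := congrArg (Nat.cast (R := F)) (Nat.choose_succ_right_eq m 2)
      push_cast [show 2 ≤ m by omega] at this
      rw [hm', sub_self, mul_zero] at this
      exact (mul_eq_zero.1 this).resolve_right (by simpa using h3)
    have e2 : x ^ 2 = y ^ 2 := moment two_pos (by omega) (by
      rw [c2]
      intro h0
      exact h3 (by linear_combination h0))
    have e3 : x ^ 3 = y ^ 3 := moment three_pos hm3 (by
      rw [c3]
      intro h0
      exact h2 (by linear_combination h0))
    rw [pow_succ, pow_succ y, e2] at e3
    exact mul_left_cancel₀ (pow_ne_zero 2 hy.ne_zero) e3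
  · simpa using moment one_pos (by omega) (by
      rw [Nat.choose_one_right]
      intro h0
      exact h5 (by linear_combination 2 * h0 + h2m))

theorem posNeighbors_injOn_not_isPos (hm : Fintype.card F = 2 * m + 1) (hm3 : 3 < m) {x y : F}
    (hx : x ≠ 0) (hx' : ¬ IsPos x) (hy : y ≠ 0) (hy' : ¬ IsPos y)
    (h : posNeighbors x = posNeighbors y) : x = y := by
  have h2m := two_mul_natCast_half_card (F := F) hm
  have hm0 : (m : F) ≠ 0 := fun h0 => by simp [h0] at h2m
  have := four_mul_sum_posNeighbors_pow hm one_pos (by omega) x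
  rw [h, four_mul_sum_posNeighbors_pow hm one_pos (by omega) y, pow_add, pow_add,
    pow_eq_neg_one_of_not_isPos hm hx hx', pow_eq_neg_one_of_not_isPos hm hy hy',
    Nat.choose_one_right] at this
  exact mul_right_cancel₀ hm0 (by linear_combination -this)

theorem image_mul_posNeighbors [DecidableEq F] {s : F} (hs : IsPos s) (x : F) :
    (posNeighbors x).image (s * ·) = posNeighbors (s * x) := by
  ext c
  simp only [Finset.mem_image, mem_posNeighbors]
  constructor
  · rintro ⟨d, ⟨h1, h2⟩, rfl⟩
    exact ⟨hs.mul h1, by rw [← mul_sub]; exact hs.mul h2⟩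
  · rintro ⟨h1, h2⟩
    refine ⟨c / s, ⟨h1.div hs, ?_⟩, mul_div_cancel₀ c hs.ne_zero⟩
    rw [← hs.mul_iff, mul_sub, mul_div_cancel₀ c hs.ne_zero]
    exact h2

theorem card_posNeighbors_mul {s : F} (hs : IsPos s) (x : F) :
    (posNeighbors (s * x)).card = (posNeighbors x).card := by
  classical
  rw [← image_mul_posNeighbors hs,
    Finset.card_image_of_injective _ (mul_right_injective₀ hs.ne_zero)]

theorem card_posNeighbors_eq_of_div {x y : F} (hx : x ≠ 0) (h : IsPos (y / x)) :
    (posNeighbors y).card = (posNeighbors x).card := by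
  rw [← card_posNeighbors_mul h x, div_mul_cancel₀ y hx]

end Positive

section Preservers

variable {F : Type*} [Field F]

theorem isPosDef_two_iff {a b c : F} :
    IsPosDef !![a, b; b, c] ↔ IsPos a ∧ IsPos (a * c - b * b) := by
  have h0 : leadingMinor !![a, b; b, c] 0 = a := by
    simp [leadingMinor, Fin.castLE]
  have h1 : leadingMinor !![a, b; b, c] 1 = a * c - b * b := by
    unfold leadingMinor
    exact Matrix.det_fin_two _
  have hs : (!![a, b; b, c]).IsSymm := by
    ext i j
    fin_cases i <;> fin_cases j <;> rfl
  rw [IsPosDef, Fin.forall_fin_two, h0, h1]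
  exact and_iff_right hs

theorem PreservesPos.isPos_of_two {f : F → F} (hf : PreservesPos 2 f) {a b c : F} (ha : IsPos a)
    (h : IsPos (a * c - b * b)) : IsPos (f a) ∧ IsPos (f a * f c - f b * f b) := by
  have h1 := hf _ (isPosDef_two_iff.2 ⟨ha, h⟩)
  have h2 : entrywiseMap f !![a, b; b, c] = !![f a, f b; f b, f c] := by
    ext i j
    fin_cases i <;> fin_cases j <;> rfl
  rwa [h2, isPosDef_two_iff] at h1

variable {f : F → F}

theorem PreservesPos.isPos_apply (hf : PreservesPos 2 f) {a : F} (ha : IsPos a) : IsPos (f a) :=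
  (hf.isPos_of_two (b := 0) (c := 1) ha (by simpa using ha)).1

variable [Fintype F]

theorem PreservesPos.exists_isPos_apply_eq (hf : PreservesPos 2 f)
    (hinj : Set.InjOn f {x | IsPos x}) {y : F} (hy : IsPos y) : ∃ x, IsPos x ∧ f x = y :=
  (((Set.toFinite {x : F | IsPos x}).injOn_iff_bijOn_of_mapsTo
    fun _ h => hf.isPos_apply h).1 hinj).surjOn hy

theorem PreservesPos.apply_zero (hf : PreservesPos 2 f) (hf1 : f 1 = 1)
    (hinj : Set.InjOn f {x | IsPos x}) : f 0 = 0 := by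
  by_contra h0
  obtain ⟨c, hc, hfc⟩ := hf.exists_isPos_apply_eq hinj (isPos_sq h0)
  have := (hf.isPos_of_two (a := 1) (b := 0) (c := c) isPos_one (by simpa using hc)).2
  rw [hfc, hf1] at this
  exact this.ne_zero (by ring)

theorem PreservesPos.apply_ne_zero (hq : Fintype.card F % 4 = 1) (hf : PreservesPos 2 f)
    (hf1 : f 1 = 1) (hinj : Set.InjOn f {x | IsPos x}) {b : F} (hb : b ≠ 0) : f b ≠ 0 := by
  intro h0
  have h : IsPos (1 * 0 - b * b) := by
    rw [one_mul, zero_sub, ← neg_one_mul, ← sq]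
    exact (isPos_neg_one hq).mul (isPos_sq hb)
  have := (hf.isPos_of_two isPos_one h).2
  rw [hf.apply_zero hf1 hinj, h0] at this
  exact this.ne_zero (by ring)

theorem PreservesPos.image_posNeighbors_div [DecidableEq F] (hq : Fintype.card F % 4 = 1)
    (hf : PreservesPos 2 f) (hf1 : f 1 = 1) (hinj : Set.InjOn f {x | IsPos x}) {a b : F}
    (ha : IsPos a) (hb : b ≠ 0) :
    (posNeighbors (b ^ 2 / a)).image f = posNeighbors (f b ^ 2 / f a) := by
  have hfa := hf.isPos_apply ha
  have hfb := hf.apply_ne_zero hq hf1 hinj hb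
  have hx := (isPos_sq hb).div ha
  apply Finset.eq_of_subset_of_card_le
  · intro d hd
    obtain ⟨c, hc, rfl⟩ := Finset.mem_image.1 hd
    rw [mem_posNeighbors] at hc ⊢
    refine ⟨hf.isPos_apply hc.1, ?_⟩
    have h : a * (c - b ^ 2 / a) = a * c - b * b := by
      rw [mul_sub, mul_div_cancel₀ _ ha.ne_zero, sq]
    have h' : f a * (f c - f b ^ 2 / f a) = f a * f c - f b * f b := by
      rw [mul_sub, mul_div_cancel₀ _ hfa.ne_zero, sq]
    rw [← hfa.mul_iff, h']
    refine (hf.isPos_of_two ha ?_).2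
    rw [← h]
    exact ha.mul hc.2
  · rw [Finset.card_image_of_injOn (hinj.mono fun c hc => (mem_posNeighbors.1 hc).1)]
    exact (card_posNeighbors_eq_of_div hx.ne_zero (((isPos_sq hfb).div hfa).div hx)).le

theorem PreservesPos.apply_sq_div {m : ℕ} (hm : Fintype.card F = 2 * m + 1) (hm3 : 3 < m)
    (hq : Fintype.card F % 4 = 1) (hf : PreservesPos 2 f) (hf1 : f 1 = 1)
    (hinj : Set.InjOn f {x | IsPos x}) {a b : F} (ha : IsPos a) (hb : b ≠ 0) :
    f (b ^ 2 / a) = f b ^ 2 / f a := by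
  classical
  have hx := (isPos_sq hb).div ha
  have hfx := hf.isPos_apply hx
  have h1 := hf.image_posNeighbors_div hq hf1 hinj ha hb
  have h2 := hf.image_posNeighbors_div hq hf1 hinj hx hx.ne_zero
  rw [sq, mul_div_cancel_right₀ _ hx.ne_zero, sq (f _), mul_div_cancel_right₀ _ hfx.ne_zero, h1]
    at h2
  exact (posNeighbors_injOn_isPos hm hm3
    ((isPos_sq (hf.apply_ne_zero hq hf1 hinj hb)).div (hf.isPos_apply ha)) hfx h2).symm

theorem PreservesPos.apply_sq {m : ℕ} (hm : Fintype.card F = 2 * m + 1) (hm3 : 3 < m)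
    (hq : Fintype.card F % 4 = 1) (hf : PreservesPos 2 f) (hf1 : f 1 = 1)
    (hinj : Set.InjOn f {x | IsPos x}) {b : F} (hb : b ≠ 0) : f (b ^ 2) = f b ^ 2 := by
  simpa [hf1] using hf.apply_sq_div hm hm3 hq hf1 hinj isPos_one hb

theorem PreservesPos.apply_mul_of_isPos {m : ℕ} (hm : Fintype.card F = 2 * m + 1) (hm3 : 3 < m)
    (hq : Fintype.card F % 4 = 1) (hf : PreservesPos 2 f) (hf1 : f 1 = 1)
    (hinj : Set.InjOn f {x | IsPos x}) {s t : F} (hs : IsPos s) (ht : IsPos t) :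
    f (s * t) = f s * f t := by
  obtain ⟨b, hb, rfl⟩ := hs
  have h1 := hf.apply_sq_div hm hm3 hq hf1 hinj ht.inv hb
  have h2 := hf.apply_sq_div hm hm3 hq hf1 hinj ht.inv one_ne_zero
  rw [one_pow, one_div, inv_inv, hf1, one_pow, one_div] at h2
  rw [div_inv_eq_mul] at h1
  rw [h1, h2, hf.apply_sq hm hm3 hq hf1 hinj hb, div_eq_mul_inv]

theorem PreservesPos.not_isPos_apply {m : ℕ} (hm : Fintype.card F = 2 * m + 1) (hm3 : 3 < m)
    (hq : Fintype.card F % 4 = 1) (hf : PreservesPos 2 f) (hf1 : f 1 = 1)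
    (hinj : Set.InjOn f {x | IsPos x}) {c : F} (hc : c ≠ 0) (hc' : ¬ IsPos c) :
    ¬ IsPos (f c) := by
  intro hfc
  obtain ⟨s, hs, hfs⟩ := hf.exists_isPos_apply_eq hinj hfc
  have h : f (s ^ 2) = f (c ^ 2) := by
    rw [hf.apply_sq hm hm3 hq hf1 hinj hs.ne_zero, hf.apply_sq hm hm3 hq hf1 hinj hc, hfs]
  rcases sq_eq_sq_iff_eq_or_eq_neg.1 (hinj (isPos_sq hs.ne_zero) (isPos_sq hc) h) with rfl | rfl
  · exact hc' hs
  · rw [← neg_one_mul, (isPos_neg_one hq).mul_iff] at hs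
    exact hc' hs

theorem PreservesPos.image_posNeighbors [DecidableEq F] {m : ℕ}
    (hm : Fintype.card F = 2 * m + 1) (hm3 : 3 < m)
    (hq : Fintype.card F % 4 = 1) (hf : PreservesPos 2 f) (hf1 : f 1 = 1)
    (hinj : Set.InjOn f {x | IsPos x}) {c : F} (hc : c ≠ 0) :
    (posNeighbors c).image f = posNeighbors (f c) := by
  by_cases hc' : IsPos c
  · have := hf.image_posNeighbors_div hq hf1 hinj hc' hc
    rwa [sq, mul_div_cancel_right₀ _ hc, sq,
      mul_div_cancel_right₀ _ (hf.isPos_apply hc').ne_zero] at this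
  · apply Finset.eq_of_subset_of_card_le
    · intro d hd
      obtain ⟨y, hy, rfl⟩ := Finset.mem_image.1 hd
      rw [mem_posNeighbors] at hy ⊢
      have hfy := hf.isPos_apply hy.1
      refine ⟨hfy, ?_⟩
      rw [isPos_sub_comm hq, ← hfy.mul_iff, mul_sub]
      refine (hf.isPos_of_two hy.1 ?_).2
      rw [← mul_sub, hy.1.mul_iff, isPos_sub_comm hq]
      exact hy.2
    · rw [Finset.card_image_of_injOn (hinj.mono fun c hc => (mem_posNeighbors.1 hc).1)]
      exact (card_posNeighbors_eq_of_div hc (isPos_div_of_not_isPos hm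
        (hf.apply_ne_zero hq hf1 hinj hc) (hf.not_isPos_apply hm hm3 hq hf1 hinj hc hc')
        hc hc')).le

theorem PreservesPos.apply_isPos_mul {m : ℕ} (hm : Fintype.card F = 2 * m + 1) (hm3 : 3 < m)
    (hq : Fintype.card F % 4 = 1) (hf : PreservesPos 2 f) (hf1 : f 1 = 1)
    (hinj : Set.InjOn f {x | IsPos x}) {s c : F} (hs : IsPos s) (hc : c ≠ 0) :
    f (s * c) = f s * f c := by
  classical
  by_cases hc' : IsPos c
  · exact hf.apply_mul_of_isPos hm hm3 hq hf1 hinj hs hc'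
  have hfs := hf.isPos_apply hs
  have hfc := hf.not_isPos_apply hm hm3 hq hf1 hinj hc hc'
  have hsc : s * c ≠ 0 := mul_ne_zero hs.ne_zero hc
  refine posNeighbors_injOn_not_isPos hm hm3 (hf.apply_ne_zero hq hf1 hinj hsc)
    (hf.not_isPos_apply hm hm3 hq hf1 hinj hsc (by rwa [hs.mul_iff]))
    (mul_ne_zero hfs.ne_zero (hf.apply_ne_zero hq hf1 hinj hc)) (by rwa [hfs.mul_iff]) ?_
  rw [← hf.image_posNeighbors hm hm3 hq hf1 hinj hsc, ← image_mul_posNeighbors hs,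
    ← image_mul_posNeighbors hfs, ← hf.image_posNeighbors hm hm3 hq hf1 hinj hc,
    Finset.image_image, Finset.image_image]
  refine Finset.image_congr fun y hy => ?_
  exact hf.apply_mul_of_isPos hm hm3 hq hf1 hinj hs (mem_posNeighbors.1 hy).1

theorem PreservesPos.apply_mul {m : ℕ} (hm : Fintype.card F = 2 * m + 1) (hm3 : 3 < m)
    (hq : Fintype.card F % 4 = 1) (hf : PreservesPos 2 f) (hf1 : f 1 = 1)
    (hinj : Set.InjOn f {x | IsPos x}) {x y : F} (hx : x ≠ 0) (hy : y ≠ 0) :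
    f (x * y) = f x * f y := by
  by_cases hx' : IsPos x
  · exact hf.apply_isPos_mul hm hm3 hq hf1 hinj hx' hy
  by_cases hy' : IsPos y
  · rw [mul_comm, mul_comm (f x)]
    exact hf.apply_isPos_mul hm hm3 hq hf1 hinj hy' hx
  have hs : IsPos (y / x) := isPos_div_of_not_isPos hm hy hy' hx hx'
  have h1 : x * y = y / x * x ^ 2 := by field_simp
  have h2 : f y = f (y / x) * f x := by
    rw [← hf.apply_isPos_mul hm hm3 hq hf1 hinj hs hx, div_mul_cancel₀ _ hx]
  rw [h1, hf.apply_isPos_mul hm hm3 hq hf1 hinj hs (pow_ne_zero 2 hx),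
    hf.apply_sq hm hm3 hq hf1 hinj hx, h2]
  ring

theorem PreservesPos.eq_one_of_apply_eq_one {m : ℕ} (hm : Fintype.card F = 2 * m + 1)
    (hm3 : 3 < m) (hq : Fintype.card F % 4 = 1) (hf : PreservesPos 2 f) (hf1 : f 1 = 1)
    (hinj : Set.InjOn f {x | IsPos x}) {x : F} (hx : x ≠ 0) (h : f x = 1) : x = 1 := by
  have hx' : IsPos x := by
    by_contra hx'
    exact hf.not_isPos_apply hm hm3 hq hf1 hinj hx hx' (h ▸ isPos_one)
  exact hinj hx' isPos_one (h.trans hf1.symm)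

theorem PreservesPos.isPos_sub_one_iff {m : ℕ} (hm : Fintype.card F = 2 * m + 1)
    (hm3 : 3 < m) (hq : Fintype.card F % 4 = 1) (hf : PreservesPos 2 f) (hf1 : f 1 = 1)
    (hinj : Set.InjOn f {x | IsPos x}) {x : F} (hx : x ≠ 0) :
    IsPos (f x - 1) ↔ IsPos (x - 1) := by
  classical
  have h1 : ∀ z : F, IsPos (z - 1) ↔ 1 ∈ posNeighbors z := fun z => by
    rw [mem_posNeighbors, isPos_sub_comm hq, and_iff_right isPos_one]
  rw [h1, h1, ← hf.image_posNeighbors hm hm3 hq hf1 hinj hx, Finset.mem_image]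
  constructor
  · rintro ⟨c, hc, hfc⟩
    rwa [← hf.eq_one_of_apply_eq_one hm hm3 hq hf1 hinj (mem_posNeighbors.1 hc).1.ne_zero hfc]
  · exact fun h => ⟨1, h, hf1⟩

theorem PreservesPos.eq_pow_of_three_lt {p m : ℕ} (hp : p.Prime) [CharP F p]
    (hm : Fintype.card F = 2 * m + 1) (hm3 : 3 < m) (hq : Fintype.card F % 4 = 1)
    (hf : PreservesPos 2 f) (hf1 : f 1 = 1) (hinj : Set.InjOn f {x | IsPos x}) :
    ∃ j, p ^ j ≤ m ∧ ∀ x, f x = x ^ p ^ j := by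
  let ψ : Fˣ →* Fˣ :=
    { toFun := fun u => Units.mk0 (f u) (hf.apply_ne_zero hq hf1 hinj u.ne_zero)
      map_one' := Units.ext hf1
      map_mul' := fun u v =>
        Units.ext (hf.apply_mul hm hm3 hq hf1 hinj u.ne_zero v.ne_zero) }
  have hψ : Function.Injective ψ := (injective_iff_map_eq_one ψ).2 fun u hu =>
    Units.ext (hf.eq_one_of_apply_eq_one hm hm3 hq hf1 hinj u.ne_zero (congrArg Units.val hu))
  let φ : Fˣ ≃* Fˣ := MulEquiv.ofBijective ψ (Finite.injective_iff_bijective.1 hψ)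
  have hφ : ∀ u, (φ u : F) = f u := fun u => rfl
  obtain ⟨j, hj, hj'⟩ := mulEquiv_units_eq_prime_pow hp hm (by omega) φ fun u => by
    rw [hφ]
    rcases eq_or_ne (u : F) 1 with hu | hu
    · rw [hu, hf1]
    have hu' : f u ≠ 1 := fun h => hu (hf.eq_one_of_apply_eq_one hm hm3 hq hf1 hinj u.ne_zero h)
    have hiff := hf.isPos_sub_one_iff hm hm3 hq hf1 hinj u.ne_zero
    by_cases h : IsPos ((u : F) - 1)
    · rw [(isPos_iff_pow hm (sub_ne_zero.2 hu)).1 h,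
        (isPos_iff_pow hm (sub_ne_zero.2 hu')).1 (hiff.2 h)]
    · rw [pow_eq_neg_one_of_not_isPos hm (sub_ne_zero.2 hu) h,
        pow_eq_neg_one_of_not_isPos hm (sub_ne_zero.2 hu') (mt hiff.1 h)]
  refine ⟨j, hj, fun x => ?_⟩
  rcases eq_or_ne x 0 with rfl | hx
  · rw [hf.apply_zero hf1 hinj, zero_pow (pow_ne_zero j hp.ne_zero)]
  · exact congrArg Units.val (hj' (Units.mk0 x hx))

theorem PreservesPos.eq_id_of_card_eq_five (h5 : Fintype.card F = 5) (hf : PreservesPos 2 f)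
    (hf1 : f 1 = 1) (hinj : Set.InjOn f {x | IsPos x}) (x : F) : f x = x := by
  have hm : Fintype.card F = 2 * 2 + 1 := h5
  have hq : Fintype.card F % 4 = 1 := by rw [h5]
  have h50 : (5 : F) = 0 := by
    have := FiniteField.cast_card_eq_zero F
    rwa [h5] at this
  have h2 : (2 : F) ≠ 0 := fun h => one_ne_zero (α := F) (by linear_combination h50 - 2 * h)
  have hpos : ∀ {z : F}, IsPos z → z = 1 ∨ z = -1 := fun {z} hz =>
    sq_eq_one_iff.1 ((isPos_iff_pow hm hz.ne_zero).1 hz)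
  have hneg : f (-1) = -1 := by
    refine (hpos (hf.isPos_apply (isPos_neg_one hq))).resolve_left fun h => h2 ?_
    have := hinj (isPos_neg_one hq) isPos_one (h.trans hf1.symm)
    linear_combination -this
  have hnz : ∀ {b : F}, b ≠ 0 → f b ≠ 0 := hf.apply_ne_zero hq hf1 hinj
  have hf2 : f 2 = 2 := by
    have h := (hf.isPos_of_two (a := 1) (b := 1) (c := 2) isPos_one
      (by convert isPos_one (F := F) using 1; norm_num)).2
    rw [hf1] at h
    rcases hpos h with h | h
    · linear_combination h
    · exact absurd (by linear_combination h) (hnz h2)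
  have hfn2 : f (-2) = -2 := by
    have h := (hf.isPos_of_two (a := -1) (b := 1) (c := -2) (isPos_neg_one hq)
      (by convert isPos_one (F := F) using 1; norm_num)).2
    rw [hf1, hneg] at h
    rcases hpos h with h | h
    · linear_combination -h
    · exact absurd (by linear_combination -h) (hnz (neg_ne_zero.2 h2))
  rcases eq_or_ne x 0 with rfl | hx
  · exact hf.apply_zero hf1 hinj
  have hx4 : (x - 1) * ((x + 1) * ((x - 2) * (x + 2))) = 0 := by
    have := FiniteField.pow_card_sub_one_eq_one x hx
    rw [h5] at this
    linear_combination this + (1 - x ^ 2) * h50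
  rcases mul_eq_zero.1 hx4 with h | h
  · rw [sub_eq_zero.1 h, hf1]
  rcases mul_eq_zero.1 h with h | h
  · rw [eq_neg_of_add_eq_zero_left h, hneg]
  rcases mul_eq_zero.1 h with h | h
  · rw [sub_eq_zero.1 h, hf2]
  · rw [eq_neg_of_add_eq_zero_left h, hfn2]

end Preservers

/-- if `q = p^k ≡ 1 (mod 4)`, `f` preserves positivity on `M_2(F_q)`,
`f 1 = 1`, and `f` is injective on `F_q⁺`, then `f x = x^{p^j}` for some `0 ≤ j ≤ k − 1`. -/
theorem stmt17 {F : Type*} [Field F] [Fintype F] (p k : ℕ) (hp : p.Prime)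
    (hcard : Fintype.card F = p ^ k) (hq : Fintype.card F % 4 = 1) (f : F → F)
    (hpres : PreservesPos 2 f) (hf1 : f 1 = 1)
    (hinj : Set.InjOn f {x : F | IsPos x}) :
    ∃ j : ℕ, j ≤ k - 1 ∧ ∀ x : F, f x = x ^ p ^ j := by
  by_cases h5 : Fintype.card F = 5
  · exact ⟨0, Nat.zero_le _, fun x => by
      rw [hpres.eq_id_of_card_eq_five h5 hf1 hinj, pow_zero, pow_one]⟩
  have := Fact.mk hp
  have : CharP F p := charP_of_card_eq_prime_pow hcard
  have hone := Fintype.one_lt_card (α := F)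
  have hm : Fintype.card F = 2 * (Fintype.card F / 2) + 1 := by omega
  obtain ⟨j, hj, hfj⟩ := hpres.eq_pow_of_three_lt hp hm (by omega) hq hf1 hinj
  refine ⟨j, ?_, hfj⟩
  have : p ^ j < p ^ k := by omega
  have := (Nat.pow_lt_pow_iff_right hp.one_lt).1 this
  omega
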